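/- Let T be a tree of diameter 5 with vertex set {v_1, ..., v_n}, where v_1 and v_2 are its two central vertices (the two adjacent vertices of eccentricity 3). For k = 1, 2, let NL_k be the set of neighbours of v_k other than v_{3-k} that are not leaves of T. Let H be the vertex-multiplication T(s_1, ..., s_n) in which the multiplicity of each vertex in NL_1 ∪ NL_2 is 4 and the multiplicity of every other vertex is 2. Then H admits an orientation D of diameter 5 in which every vertex lies on a directed cycle of length at most 4. -/

import Mathlib

open SimpleGraph

variable {V : Type*}

/-- `D` is an orientation of `G`: every arc of `D` is an edge of `G`, and every edge of `G`
receives exactly one of the two possible directions. -/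
def IsOrientation (G : SimpleGraph V) (D : V → V → Prop) : Prop :=
  (∀ u v, D u v → G.Adj u v) ∧ ∀ u v, G.Adj u v → (D u v ↔ ¬ D v u)

/-- There is a directed walk of length `n` from `u` to `v` in the digraph `D`. -/
def DPath (D : V → V → Prop) : ℕ → V → V → Prop
  | 0, u, v => u = v
  | n + 1, u, v => ∃ w, D u w ∧ DPath D n w v

/-- Directed distance from `u` to `v` (`⊤` if `v` is not reachable from `u`). -/
noncomputable def ddist (D : V → V → Prop) (u v : V) : ℕ∞ :=
  sInf {n : ℕ∞ | ∃ m : ℕ, n = (m : ℕ∞) ∧ DPath D m u v}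

/-- Diameter of a digraph: supremum of directed distances over all ordered pairs. -/
noncomputable def odiam (D : V → V → Prop) : ℕ∞ :=
  ⨆ u : V, ⨆ v : V, ddist D u v

/-- A strong orientation of `G`: an orientation in which every vertex is reachable
from every other vertex by a directed path. -/
def IsStrongOrientation (G : SimpleGraph V) (D : V → V → Prop) : Prop :=
  IsOrientation G D ∧ ∀ u v, ∃ m : ℕ, DPath D m u v

/-- The orientation number of `G`: minimum diameter over all strong orientations. -/
noncomputable def orientNum (G : SimpleGraph V) : ℕ∞ :=
  sInf {d : ℕ∞ | ∃ D : V → V → Prop, IsStrongOrientation G D ∧ d = odiam D}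

/-- The vertex-multiplication `G(s)`: vertex `v` is replaced by `s v` copies, and copies of
`v_i`, `v_j` are adjacent iff `v_i v_j` is an edge of `G` (whence `i ≠ j`). -/
def vertexMult (G : SimpleGraph V) (s : V → ℕ) : SimpleGraph (Σ v : V, Fin (s v)) where
  Adj x y := G.Adj x.1 y.1
  symm := ⟨fun _ _ h => G.symm.symm _ _ h⟩
  loopless := ⟨fun x h => G.loopless.irrefl x.1 h⟩

/-- Eccentricity of a vertex. -/
noncomputable def ecc (G : SimpleGraph V) (v : V) : ℕ∞ :=
  ⨆ u : V, G.edist v u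

theorem DPath.trans {D : V → V → Prop} {m n : ℕ} {u v w : V}
    (h : DPath D m u v) (h' : DPath D n v w) : DPath D (m + n) u w := by
  induction m generalizing u with
  | zero => obtain rfl : u = v := h; simpa using h'
  | succ m ih =>
    obtain ⟨x, hx, hxv⟩ := h
    rw [Nat.add_right_comm]
    exact ⟨x, hx, ih hxv⟩

theorem DPath.of_arc {D : V → V → Prop} {u v : V} (h : D u v) : DPath D 1 u v :=
  ⟨v, h, rfl⟩

theorem DPath.of_arc_arc {D : V → V → Prop} {u v w : V} (h : D u v) (h' : D v w) :
    DPath D 2 u w :=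
  (DPath.of_arc h).trans (DPath.of_arc h')

/-- A directed walk in an orientation of a vertex-multiplication is at least as long as the
distance of the underlying vertices. -/
theorem edist_le_of_dpath {T : SimpleGraph V} {s : V → ℕ}
    {D : (Σ v : V, Fin (s v)) → (Σ v : V, Fin (s v)) → Prop}
    (hD : ∀ x y, D x y → T.Adj x.1 y.1) {m : ℕ} {x y : Σ v : V, Fin (s v)}
    (h : DPath D m x y) : T.edist x.1 y.1 ≤ m := by
  induction m generalizing x with
  | zero => obtain rfl : x = y := h; simp
  | succ m ih =>
    obtain ⟨z, hz, hzy⟩ := h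
    have h₁ : T.edist x.1 z.1 ≤ 1 := (edist_eq_one_iff_adj.mpr (hD _ _ hz)).le
    calc T.edist x.1 y.1 ≤ T.edist x.1 z.1 + T.edist z.1 y.1 := T.edist_triangle
      _ ≤ 1 + m := add_le_add h₁ (ih hzy)
      _ = ((m + 1 : ℕ) : ℕ∞) := by push_cast; rw [add_comm]

section FourCycle

variable {D : V → V → Prop} {c : Fin 4 → V}

theorem dpath_fourCycle (hc : ∀ i, D (c i) (c (i + 1))) (i j : Fin 4) :
    DPath D (j - i).val (c i) (c j) := by
  have step : ∀ (k : ℕ) (i j : Fin 4), (j - i).val = k → DPath D k (c i) (c j) := by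
    intro k
    induction k with
    | zero =>
      intro i j h
      have : i = j := by lia
      exact congrArg c this
    | succ k ih =>
      intro i j h
      exact ⟨_, hc i, ih _ _ (by lia)⟩
  exact step _ i j rfl

theorem dpath_fourCycle_near_left (hc : ∀ i, D (c i) (c (i + 1))) (i j : Fin 4) :
    ∃ m ≤ 1, DPath D m (c i) (c j) ∨ DPath D m (c (i + 2)) (c j) := by
  have h : (j - i).val ≤ 1 ∨ (j - (i + 2)).val ≤ 1 := by revert i j; decide
  rcases h with h | h
  · exact ⟨_, h, .inl (dpath_fourCycle hc _ _)⟩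
  · exact ⟨_, h, .inr (dpath_fourCycle hc _ _)⟩

theorem dpath_fourCycle_near_right (hc : ∀ i, D (c i) (c (i + 1))) (i j : Fin 4) :
    ∃ m ≤ 1, DPath D m (c i) (c j) ∨ DPath D m (c i) (c (j + 2)) := by
  have h : (j - i).val ≤ 1 ∨ (j + 2 - i).val ≤ 1 := by revert i j; decide
  rcases h with h | h
  · exact ⟨_, h, .inl (dpath_fourCycle hc _ _)⟩
  · exact ⟨_, h, .inr (dpath_fourCycle hc _ _)⟩

/-- The position of a vertex `x` relative to a directed 4-cycle `c`: it lies on `c`, or it is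
joined to two antipodal vertices of `c` by one arc in each direction, or it is joined to two
antipodal vertices of `c` by walks of length two in both directions. -/
def Attached (D : V → V → Prop) (c : Fin 4 → V) (x : V) : Prop :=
  (∃ i, x = c i) ∨ (∃ i, D x (c i) ∧ D (c (i + 2)) x) ∨
    ∃ i, (DPath D 2 x (c i) ∧ DPath D 2 x (c (i + 2))) ∧
      DPath D 2 (c i) x ∧ DPath D 2 (c (i + 2)) x

theorem Attached.exists_dpath_to_cycle {x : V} (h : Attached D c x) :
    (∃ i, ∃ m ≤ 1, DPath D m x (c i)) ∨ ∃ i, DPath D 2 x (c i) ∧ DPath D 2 x (c (i + 2)) := by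
  rcases h with ⟨i, hi⟩ | ⟨i, hi, -⟩ | ⟨i, hi, -⟩
  · exact .inl ⟨i, 0, by simp, hi⟩
  · exact .inl ⟨i, 1, le_rfl, .of_arc hi⟩
  · exact .inr ⟨i, hi⟩

theorem Attached.exists_dpath_from_cycle {x : V} (h : Attached D c x) :
    (∃ i, ∃ m ≤ 1, DPath D m (c i) x) ∨ ∃ i, DPath D 2 (c i) x ∧ DPath D 2 (c (i + 2)) x := by
  rcases h with ⟨i, hi⟩ | ⟨i, -, hi⟩ | ⟨i, -, hi⟩
  · exact .inl ⟨i, 0, by simp, hi.symm⟩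
  · exact .inl ⟨i + 2, 1, le_rfl, .of_arc hi⟩
  · exact .inr ⟨i, hi⟩

theorem Attached.exists_dpath (hc : ∀ i, D (c i) (c (i + 1))) {x y : V}
    (hx : Attached D c x) (hy : Attached D c y) : ∃ m ≤ 5, DPath D m x y := by
  rcases hx.exists_dpath_to_cycle with ⟨i, m, hm, hi⟩ | ⟨i, hi, hi'⟩ <;>
    rcases hy.exists_dpath_from_cycle with ⟨j, n, hn, hj⟩ | ⟨j, hj, hj'⟩
  · exact ⟨_, by lia, (hi.trans (dpath_fourCycle hc i j)).trans hj⟩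
  · obtain ⟨k, hk, h | h⟩ := dpath_fourCycle_near_right hc i j
    · exact ⟨_, by lia, (hi.trans h).trans hj⟩
    · exact ⟨_, by lia, (hi.trans h).trans hj'⟩
  · obtain ⟨k, hk, h | h⟩ := dpath_fourCycle_near_left hc i j
    · exact ⟨_, by lia, (hi.trans h).trans hj⟩
    · exact ⟨_, by lia, (hi'.trans h).trans hj⟩
  · obtain ⟨k, hk, h | h⟩ := dpath_fourCycle_near_left hc i j
    · exact ⟨_, by lia, (hi.trans h).trans hj⟩
    · exact ⟨_, by lia, (hi'.trans h).trans hj⟩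

theorem Attached.exists_cycle (hc : ∀ i, D (c i) (c (i + 1))) {x : V}
    (hx : Attached D c x) : ∃ k, 1 ≤ k ∧ k ≤ 4 ∧ DPath D k x x := by
  rcases hx with ⟨i, rfl⟩ | ⟨i, hi, hi'⟩ | ⟨i, ⟨hi, -⟩, hi', -⟩
  · exact ⟨_, by lia, by lia, (DPath.of_arc (hc i)).trans (dpath_fourCycle hc (i + 1) i)⟩
  · have h := dpath_fourCycle hc i (i + 2)
    exact ⟨_, by lia, by lia, ((DPath.of_arc hi).trans h).trans (DPath.of_arc hi')⟩
  · exact ⟨4, by simp, le_rfl, hi.trans hi'⟩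

end FourCycle

/-- Orientation of a vertex-multiplication, given a rank on the vertices that separates the ends of
every edge: an edge between `x` and `y`, the latter of smaller rank, is directed from `x` to `y`
exactly when `f x y` holds. -/
def rankOrientation (T : SimpleGraph V) {s : V → ℕ} (r : V → ℕ)
    (f : (Σ v : V, Fin (s v)) → (Σ v : V, Fin (s v)) → Prop) (x y : Σ v : V, Fin (s v)) : Prop :=
  T.Adj x.1 y.1 ∧ (r y.1 < r x.1 ∧ f x y ∨ r x.1 < r y.1 ∧ ¬ f y x)

theorem isOrientation_rankOrientation {T : SimpleGraph V} {s : V → ℕ} {r : V → ℕ}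
    (hr : ∀ u v, T.Adj u v → r u ≠ r v)
    (f : (Σ v : V, Fin (s v)) → (Σ v : V, Fin (s v)) → Prop) :
    IsOrientation (vertexMult T s) (rankOrientation T r f) := by
  refine ⟨fun _ _ h => h.1, fun x y h => ?_⟩
  have h₁ : T.Adj x.1 y.1 := h
  have h₂ := hr _ _ h₁
  unfold rankOrientation
  rcases lt_or_gt_of_ne h₂ with h₃ | h₃ <;> simp [h₁, h₁.symm, h₃, h₃.not_gt]

/-- The direction of an edge from a copy of a vertex to a copy of its parent: towards a central
vertex, match the parities of the indices; otherwise, go to the first two copies of the parent. -/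
def towardsParent (v₁ v₂ : V) {s : V → ℕ} (x y : Σ v : V, Fin (s v)) : Prop :=
  (y.1 = v₁ ∨ y.1 = v₂) ∧ x.2.val % 2 = y.2.val % 2 ∨
    ¬ (y.1 = v₁ ∨ y.1 = v₂) ∧ y.2.val < 2

/-- In a tree in which the adjacent vertices `v₁`, `v₂` have eccentricity at most three, every
vertex is central, or a child of a central vertex `c`, or a grandchild of a central vertex `c`
through a noncentral vertex, for the tree rooted at `v₁`. -/
theorem exists_central_ancestor {T : SimpleGraph V} (hT : T.IsTree) {v₁ v₂ : V}
    (hadj : T.Adj v₁ v₂) (hecc₁ : ecc T v₁ ≤ 3) (hecc₂ : ecc T v₂ ≤ 3) (w : V) :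
    (w = v₁ ∨ w = v₂) ∨ ∃ c, (c = v₁ ∨ c = v₂) ∧
      (T.Adj w c ∧ T.dist v₁ c < T.dist v₁ w ∨
        ∃ p, T.Adj w p ∧ T.Adj p c ∧ p ≠ v₁ ∧ p ≠ v₂ ∧
          T.dist v₁ c < T.dist v₁ p ∧ T.dist v₁ p < T.dist v₁ w) := by
  have hcon := hT.connected
  have hle : ∀ v, ecc T v ≤ 3 → T.dist v w ≤ 3 := fun v hv => by
    have h : T.edist v w ≤ 3 := (le_iSup (fun u => T.edist v u) w).trans hv
    rw [← (hcon v w).coe_dist_eq_edist] at h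
    exact_mod_cast h
  have h₁ := hle v₁ hecc₁
  have h₂ := hle v₂ hecc₂
  have hne : T.dist w v₁ ≠ T.dist w v₂ := hT.dist_ne_of_adj w hadj
  rw [T.dist_comm (u := w), T.dist_comm (u := w)] at hne
  have h₁₂ : T.dist v₁ v₂ = 1 := dist_eq_one_iff_adj.mpr hadj
  have h₂₁ : T.dist v₂ v₁ = 1 := dist_eq_one_iff_adj.mpr hadj.symm
  have h₁₁ : T.dist v₁ v₁ = 0 := dist_self
  have h₂₂ : T.dist v₂ v₂ = 0 := dist_self
  have split : ∀ v, T.dist v w ≤ 2 → v = w ∨ (T.Adj w v ∧ T.dist v w = 1) ∨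
      ∃ p, T.Adj w p ∧ T.Adj p v ∧ T.dist v p = 1 ∧ T.dist v w = 2 := fun v hv => by
    obtain ⟨q, hq⟩ := (hcon v w).exists_walk_length_eq_dist
    match q, hq with
    | .nil, _ => exact .inl rfl
    | .cons h .nil, hq => exact .inr (.inl ⟨h.symm, by simpa using hq.symm⟩)
    | .cons (v := p) h (.cons h' .nil), hq =>
      exact .inr (.inr ⟨p, h'.symm, h.symm, dist_eq_one_iff_adj.mpr h, by simpa using hq.symm⟩)
    | .cons _ (.cons _ (.cons _ _)), hq => simp at hq; lia
  have tri : ∀ p, T.dist v₁ p ≤ T.dist v₁ v₂ + T.dist v₂ p := fun p => hcon.dist_triangle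
  rcases lt_or_gt_of_ne hne with hlt | hlt
  · rcases split v₁ (by lia) with h | ⟨h, hd⟩ | ⟨p, hwp, hpv, hd, hd'⟩
    · exact .inl (.inl h.symm)
    · exact .inr ⟨v₁, .inl rfl, .inl ⟨h, by lia⟩⟩
    · refine .inr ⟨v₁, .inl rfl, .inr ⟨p, hwp, hpv, hpv.ne, ?_, by lia, by lia⟩⟩
      rintro rfl
      have : T.dist p w = 1 := dist_eq_one_iff_adj.mpr hwp.symm
      lia
  · rcases split v₂ (by lia) with h | ⟨h, hd⟩ | ⟨p, hwp, hpv, hd, hd'⟩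
    · exact .inl (.inr h.symm)
    · exact .inr ⟨v₂, .inr rfl, .inl ⟨h, by lia⟩⟩
    · have hp : p ≠ v₁ := by
        rintro rfl
        have : T.dist p w = 1 := dist_eq_one_iff_adj.mpr hwp.symm
        lia
      have hp₀ : T.dist v₁ p ≠ 0 := fun h => hp ((hcon v₁ p).dist_eq_zero_iff.mp h).symm
      have hp₁ : T.dist v₁ v₂ ≠ T.dist v₁ p := hT.dist_ne_of_adj v₁ hpv.symm
      have := tri p
      exact .inr ⟨v₂, .inr rfl, .inr ⟨p, hwp, hpv, hp, hpv.ne, by lia, by lia⟩⟩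

theorem stmt16 [Fintype V] (T : SimpleGraph V) (hT : T.IsTree) (hdiam : T.ediam = 5)
    (v₁ v₂ : V) (hadj : T.Adj v₁ v₂) (hecc₁ : ecc T v₁ = 3) (hecc₂ : ecc T v₂ = 3)
    (NL₁ NL₂ : Set V)
    (hNL₁ : NL₁ = {u : V | T.Adj v₁ u ∧ u ≠ v₂ ∧ (T.neighborSet u).ncard ≠ 1})
    (hNL₂ : NL₂ = {u : V | T.Adj v₂ u ∧ u ≠ v₁ ∧ (T.neighborSet u).ncard ≠ 1})
    (s : V → ℕ) (hs4 : ∀ v ∈ NL₁ ∪ NL₂, s v = 4) (hs2 : ∀ v ∉ NL₁ ∪ NL₂, s v = 2) :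
    ∃ D : (Σ v : V, Fin (s v)) → (Σ v : V, Fin (s v)) → Prop,
      IsOrientation (vertexMult T s) D ∧ odiam D = 5 ∧
      ∀ x : Σ v : V, Fin (s v), ∃ k : ℕ, 1 ≤ k ∧ k ≤ 4 ∧ DPath D k x x := by
  have hs₁ : s v₁ = 2 := hs2 v₁ (by simp [hNL₁, hNL₂])
  have hs₂ : s v₂ = 2 := hs2 v₂ (by simp [hNL₁, hNL₂])
  have hpos : ∀ v, 2 ≤ s v := fun v => by
    by_cases h : v ∈ NL₁ ∪ NL₂
    · simp [hs4 v h]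
    · simp [hs2 v h]
  set D := rankOrientation T (s := s) (T.dist v₁) (towardsParent v₁ v₂) with hD
  have hor : IsOrientation (vertexMult T s) D :=
    isOrientation_rankOrientation (fun _ _ h => hT.dist_ne_of_adj v₁ h) _
  have hup : ∀ x y : Σ v : V, Fin (s v), T.Adj x.1 y.1 → T.dist v₁ y.1 < T.dist v₁ x.1 →
      (D x y ↔ towardsParent v₁ v₂ x y) ∧ (D y x ↔ ¬ towardsParent v₁ v₂ x y) := by
    intro x y h hlt
    simp [hD, rankOrientation, h, h.symm, hlt, hlt.not_gt]
  have h₁₂ : T.dist v₁ v₁ < T.dist v₁ v₂ := by simp [dist_eq_one_iff_adj.mpr hadj]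
  let c : Fin 4 → Σ v : V, Fin (s v) :=
    ![⟨v₁, 0, by lia⟩, ⟨v₂, 1, by lia⟩, ⟨v₁, 1, by lia⟩, ⟨v₂, 0, by lia⟩]
  have hc : ∀ i, D (c i) (c (i + 1)) := by
    intro i
    fin_cases i
    · exact (hup ⟨v₂, 1, by lia⟩ ⟨v₁, 0, by lia⟩ hadj.symm h₁₂).2.mpr (by simp [towardsParent])
    · exact (hup ⟨v₂, 1, by lia⟩ ⟨v₁, 1, by lia⟩ hadj.symm h₁₂).1.mpr (by simp [towardsParent])
    · exact (hup ⟨v₂, 0, by lia⟩ ⟨v₁, 1, by lia⟩ hadj.symm h₁₂).2.mpr (by simp [towardsParent])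
    · exact (hup ⟨v₂, 0, by lia⟩ ⟨v₁, 0, by lia⟩ hadj.symm h₁₂).1.mpr (by simp [towardsParent])
  have hcopy : ∀ v, v = v₁ ∨ v = v₂ → ∃ i : Fin 4, ∃ (h₀ : 0 < s v) (h₁ : 1 < s v),
      c i = ⟨v, 0, h₀⟩ ∧ c (i + 2) = ⟨v, 1, h₁⟩ := by
    rintro v (rfl | rfl)
    · exact ⟨0, by lia, by lia, rfl, rfl⟩
    · exact ⟨3, by lia, by lia, rfl, rfl⟩
  have hadd : ∀ i : Fin 4, i + 2 + 2 = i := by decide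
  have hatt : ∀ x, Attached D c x := by
    rintro ⟨w, k⟩
    rcases exists_central_ancestor hT hadj hecc₁.le hecc₂.le w with
      hw | ⟨v, hv, ⟨hwv, hlt⟩ | ⟨p, hwp, hpv, hp₁, hp₂, hlt, hlt'⟩⟩
    · obtain ⟨i, h₀, h₁, hi, hi'⟩ := hcopy w hw
      have hk : k.val < 2 := by
        have := k.isLt
        rcases hw with rfl | rfl <;> lia
      left
      obtain hk | hk : k.val = 0 ∨ k.val = 1 := by lia
      · exact ⟨i, by rw [hi]; congr; exact Fin.ext hk⟩
      · exact ⟨i + 2, by rw [hi']; congr; exact Fin.ext hk⟩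
    · obtain ⟨i, h₀, h₁, hi, hi'⟩ := hcopy v hv
      right; left
      rcases Nat.mod_two_eq_zero_or_one k.val with hk | hk
      · refine ⟨i, ?_, ?_⟩
        · rw [hi]; exact (hup _ _ hwv hlt).1.mpr (by simp [towardsParent, hv, hk])
        · rw [hi']; exact (hup _ _ hwv hlt).2.mpr (by simp [towardsParent, hv, hk])
      · refine ⟨i + 2, ?_, ?_⟩
        · rw [hi']; exact (hup _ _ hwv hlt).1.mpr (by simp [towardsParent, hv, hk])
        · rw [hadd, hi]; exact (hup _ _ hwv hlt).2.mpr (by simp [towardsParent, hv, hk])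
    · obtain ⟨i, h₀, h₁, hi, hi'⟩ := hcopy v hv
      have hcard : (T.neighborSet p).ncard ≠ 1 := by
        intro h
        obtain ⟨a, ha⟩ := Set.ncard_eq_one.mp h
        have e₁ : w ∈ T.neighborSet p := hwp.symm
        have e₂ : v ∈ T.neighborSet p := hpv
        rw [ha, Set.mem_singleton_iff] at e₁ e₂
        rw [e₁, ← e₂] at hlt'
        lia
      have hsp : s p = 4 := by
        refine hs4 p ?_
        rw [hNL₁, hNL₂]
        rcases hv with rfl | rfl
        · exact .inl ⟨hpv.symm, hp₂, hcard⟩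
        · exact .inr ⟨hpv.symm, hp₁, hcard⟩
      right; right
      have hout : ∀ j (hj : j < s p), j < 2 → D ⟨w, k⟩ ⟨p, j, hj⟩ := fun j hj h =>
        (hup _ _ hwp hlt').1.mpr (by simp [towardsParent, hp₁, hp₂, h])
      have hin : ∀ j (hj : j < s p), 2 ≤ j → D ⟨p, j, hj⟩ ⟨w, k⟩ := fun j hj h =>
        (hup _ _ hwp hlt').2.mpr (by simp [towardsParent, hp₁, hp₂]; lia)
      have hto : ∀ j (hj : j < s p) l (hl : l < s v), j % 2 = l % 2 →
          D ⟨p, j, hj⟩ ⟨v, l, hl⟩ := fun j hj l hl h =>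
        (hup _ _ hpv hlt).1.mpr (by simp [towardsParent, hv, h])
      have hfrom : ∀ j (hj : j < s p) l (hl : l < s v), j % 2 ≠ l % 2 →
          D ⟨v, l, hl⟩ ⟨p, j, hj⟩ := fun j hj l hl h =>
        (hup _ _ hpv hlt).2.mpr (by simp [towardsParent, hv, h])
      refine ⟨i, ?_⟩
      rw [hi, hi']
      exact ⟨⟨.of_arc_arc (hout 0 (by lia) (by lia)) (hto 0 _ 0 _ (by lia)),
        .of_arc_arc (hout 1 (by lia) (by lia)) (hto 1 _ 1 _ (by lia))⟩,
        .of_arc_arc (hfrom 3 (by lia) 0 _ (by lia)) (hin 3 _ (by lia)),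
        .of_arc_arc (hfrom 2 (by lia) 1 _ (by lia)) (hin 2 _ (by lia))⟩
  refine ⟨D, hor, le_antisymm ?_ ?_, fun x => (hatt x).exists_cycle hc⟩
  · refine iSup₂_le fun x y => ?_
    obtain ⟨m, hm, h⟩ := (hatt x).exists_dpath hc (hatt y)
    have hle : ddist D x y ≤ m := sInf_le ⟨m, rfl, h⟩
    exact hle.trans (by exact_mod_cast hm)
  · have : Nonempty V := ⟨v₁⟩
    obtain ⟨u, v, huv⟩ := T.exists_edist_eq_ediam_of_finite
    rw [hdiam] at huv
    have hu := hpos u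
    have hv := hpos v
    refine le_trans ?_ (le_iSup₂ (f := fun x y => ddist D x y) ⟨u, 0, by lia⟩ ⟨v, 0, by lia⟩)
    refine le_sInf ?_
    rintro _ ⟨m, rfl, h⟩
    exact huv.symm.le.trans (edist_le_of_dpath hor.1 h)
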